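/- arXiv:2204.02335 — 2 statements merged into one kernel-verified Lean document; each statement's English description precedes it below -/
import Mathlib

section
/- In the iterative ball-coloring process on G with parameter R > 0 and any stopping time τ, if the choice of each center v_t depends only on the original graph G and on which vertices have been removed before time step t (and in particular not on the path P), then the random variable X counting, at the stopping time τ, the number of indices 0 ≤ i < Q such that p_i and p_{i+1} have different colors satisfies E[X] ≤ 4Q/R. -/
/- STATEMENT 6: the ball-coloring supermartingale lemma. In the iterative ball-coloring
process on an unweighted graph G with parameter R > 0 — at each step t a center v_t
(chosen as a deterministic function of the removal history only, in particular not of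
the path P) is picked in the remaining graph, a radius r_t ~ Expo(R) is sampled
independently, and the ball of hop-radius r_t around v_t in the remaining graph is
colored with color t and removed — for any stopping time τ (a function of the removal
history, bounded by |V|), the number X of indices 0 ≤ i < Q such that p_i and p_{i+1}
have different colors at time τ satisfies E[X] ≤ 4Q/R, where P = (p_0, …, p_Q) is any
fixed path in G. -/

open MeasureTheory Real
open scoped ENNReal

attribute [local instance] Classical.propDecidable

/-- The exponential distribution with mean `R`. -/
noncomputable def expo (R : ℝ) : Measure ℝ :=
  MeasureTheory.volume.withDensity fun x =>
    ENNReal.ofReal (if 0 ≤ x then (1 / R) * Real.exp (-x / R) else 0)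

/-- The ball of hop-radius `ρ` around `v` in the subgraph of `G` induced on `A`
(vertices reachable from `v` by a walk of length at most `ρ` staying inside `A`). -/
def ballIn {V : Type} (G : SimpleGraph V) (A : Set V) (v : V) (ρ : ℝ) : Set V :=
  {u | ∃ p : G.Walk v u, (p.length : ℝ) ≤ ρ ∧ ∀ x ∈ p.support, x ∈ A}

/-- Removal history of the coloring process: `histC G choose r t` is the list
`[rem t, …, rem 1, rem 0]` of remaining vertex sets after each of the first `t` steps;
at step `t` the center `choose l` is a deterministic function of the history `l` only,
and the ball of radius `r t` around it in the remaining graph is removed. -/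
def histC {V : Type} (G : SimpleGraph V) (choose : List (Set V) → V) (r : ℕ → ℝ) :
    ℕ → List (Set V)
  | 0 => [Set.univ]
  | t + 1 =>
      let l := histC G choose r t
      (l.headI \ ballIn G l.headI (choose l) (r t)) :: l

/-- The set of vertices remaining after `t` steps of the coloring process. -/
def remC {V : Type} (G : SimpleGraph V) (choose : List (Set V) → V) (r : ℕ → ℝ)
    (t : ℕ) : Set V :=
  (histC G choose r t).headI

/-- The ball colored (and removed) at step `t`. -/
def ballAtC {V : Type} (G : SimpleGraph V) (choose : List (Set V) → V) (r : ℕ → ℝ)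
    (t : ℕ) : Set V :=
  remC G choose r t \ remC G choose r (t + 1)

/-- Color of `v` after `upTo` steps: color `t+1` if `v` was removed at step `t < upTo`,
and color `0` if `v` has not been removed. -/
noncomputable def colC {V : Type} (G : SimpleGraph V) (choose : List (Set V) → V)
    (r : ℕ → ℝ) (upTo : ℕ) (v : V) : ℕ :=
  if h : ∃ t, t < upTo ∧ v ∈ ballAtC G choose r t then Nat.find h + 1 else 0

/-- Extension of finitely many sampled radii to a sequence. -/
def rOf {n : ℕ} (ω : Fin n → ℝ) (t : ℕ) : ℝ :=
  if h : t < n then ω ⟨t, h⟩ else 0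

section Helpers

lemma expo_Ici (R : ℝ) (hR : 0 < R) (d : ℝ) (hd : 0 ≤ d) :
    expo R (Set.Ici d) = ENNReal.ofReal (Real.exp (-d / R)) := by
  have hneg : -(1 / R) < 0 := by
    have : 0 < 1 / R := by positivity
    linarith
  rw [expo, withDensity_apply _ measurableSet_Ici]
  have h1 : ∫⁻ x in Set.Ici d,
      ENNReal.ofReal (if 0 ≤ x then (1 / R) * Real.exp (-x / R) else 0)
      = ∫⁻ x in Set.Ici d, ENNReal.ofReal ((1 / R) * Real.exp (-(1 / R) * x)) := by
    refine setLIntegral_congr_fun measurableSet_Ici ?_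
    intro x hx
    have hx' : 0 ≤ x := le_trans hd hx
    have h2 : -x / R = -(1 / R) * x := by field_simp
    simp only [if_pos hx', h2]
  rw [h1, setLIntegral_congr Ioi_ae_eq_Ici.symm, ← ofReal_integral_eq_lintegral_ofReal]
  · rw [integral_const_mul, integral_exp_mul_Ioi hneg]
    congr 1
    have h2 : -d / R = -(1 / R) * d := by field_simp
    rw [h2]
    field_simp
  · exact (integrableOn_exp_mul_Ioi hneg d).const_mul _
  · filter_upwards with x
    positivity

lemma expo_Ico (R : ℝ) (hR : 0 < R) (d : ℝ) (hd : 0 ≤ d) :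
    expo R (Set.Ico d (d + 1)) ≤ ENNReal.ofReal (1 / R) * expo R (Set.Ici d) := by
  rw [expo_Ici R hR d hd, expo, withDensity_apply _ measurableSet_Ico]
  calc _ ≤ ∫⁻ x in Set.Ico d (d + 1), ENNReal.ofReal (1 / R * Real.exp (-d / R)) := by
        refine setLIntegral_mono measurable_const ?_
        intro x hx
        apply ENNReal.ofReal_le_ofReal
        rw [if_pos (le_trans hd hx.1)]
        have := hx.1
        gcongr
    _ = ENNReal.ofReal (1 / R) * ENNReal.ofReal (Real.exp (-d / R)) := by
        rw [setLIntegral_const, Real.volume_Ico, ← ENNReal.ofReal_mul (by positivity),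
          add_sub_cancel_left, mul_one, ENNReal.ofReal_mul (by positivity)]

lemma expo_prob (R : ℝ) (hR : 0 < R) : IsProbabilityMeasure (expo R) := by
  constructor
  have h0 : expo R (Set.Iio 0) = 0 := by
    rw [expo, withDensity_apply _ measurableSet_Iio]
    rw [setLIntegral_congr_fun (g := fun _ => 0) measurableSet_Iio]
    · simp
    · intro x hx
      have hx' : x < 0 := hx
      simp [not_le.mpr hx']
  have h1 := expo_Ici R hR 0 le_rfl
  rw [← Set.Iio_union_Ici (a := (0 : ℝ)), measure_union (by
    rw [Set.disjoint_left]; intro x hx hx'; exact absurd (Set.mem_Iio.mp hx) (not_lt.mpr (Set.mem_Ici.mp hx'))) measurableSet_Ici,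
    h0, h1]
  simp

variable {V : Type} (G : SimpleGraph V)

lemma ballIn_mono (A : Set V) (c : V) {ρ ρ' : ℝ} (h : ρ ≤ ρ') :
    ballIn G A c ρ ⊆ ballIn G A c ρ' := by
  rintro u ⟨p, hp, hA⟩
  exact ⟨p, hp.trans h, hA⟩

lemma ballIn_step (A : Set V) (c a b : V) (hab : G.Adj a b) (hb : b ∈ A) {k : ℕ} {ρ : ℝ}
    (hk : a ∈ ballIn G A c k) (h : (k : ℝ) + 1 ≤ ρ) : b ∈ ballIn G A c ρ := by
  obtain ⟨p, hp, hA⟩ := hk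
  refine ⟨p.concat hab, ?_, ?_⟩
  · rw [SimpleGraph.Walk.length_concat]; push_cast; linarith
  · intro x hx
    rw [SimpleGraph.Walk.support_concat] at hx
    simp only [List.concat_eq_append, List.mem_append, List.mem_singleton] at hx
    rcases hx with hx | rfl
    · exact hA x hx
    · exact hb

lemma ballIn_nat (A : Set V) (c a : V) {ρ : ℝ} (h : a ∈ ballIn G A c ρ) :
    ∃ k : ℕ, (k : ℝ) ≤ ρ ∧ a ∈ ballIn G A c k := by
  obtain ⟨p, hp, hA⟩ := h
  exact ⟨p.length, hp, p, le_rfl, hA⟩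

lemma one_dim (R : ℝ) (hR : 0 < R) (A : Set V) (c a b : V) (hab : G.Adj a b) (ha : a ∈ A)
    (hb : b ∈ A) :
    expo R {ρ | ¬ (a ∈ ballIn G A c ρ ↔ b ∈ ballIn G A c ρ)} ≤
      ENNReal.ofReal (1 / R) * expo R {ρ | a ∈ ballIn G A c ρ ∨ b ∈ ballIn G A c ρ} := by
  by_cases h : ∃ k : ℕ, a ∈ ballIn G A c k ∨ b ∈ ballIn G A c k
  · have hs := Nat.find_spec h
    have hmin : ∀ ρ, (a ∈ ballIn G A c ρ ∨ b ∈ ballIn G A c ρ) → (Nat.find h : ℝ) ≤ ρ := by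
      intro ρ hρ
      have : ∃ k : ℕ, (k : ℝ) ≤ ρ ∧ (a ∈ ballIn G A c k ∨ b ∈ ballIn G A c k) := by
        rcases hρ with hρ | hρ
        · obtain ⟨k, hk, hk'⟩ := ballIn_nat G A c a hρ
          exact ⟨k, hk, Or.inl hk'⟩
        · obtain ⟨k, hk, hk'⟩ := ballIn_nat G A c b hρ
          exact ⟨k, hk, Or.inr hk'⟩
      obtain ⟨k, hk, hk'⟩ := this
      have : Nat.find h ≤ k := Nat.find_min' h hk'
      exact le_trans (by exact_mod_cast this) hk
    generalize Nat.find h = d at hs hmin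
    refine le_trans (measure_mono ?_) (le_trans (expo_Ico R hR d (by positivity)) ?_)
    · intro ρ hρ
      simp only [Set.mem_ofPred_eq] at hρ
      refine ⟨hmin ρ (by tauto), ?_⟩
      by_contra hlt
      rw [not_lt] at hlt
      apply hρ
      have hd : (d : ℝ) ≤ ρ := by linarith
      rcases hs with hs | hs
      · exact ⟨fun _ => ballIn_step G A c a b hab hb hs hlt, fun _ => ballIn_mono G A c hd hs⟩
      · exact ⟨fun _ => ballIn_mono G A c hd hs,
          fun _ => ballIn_step G A c b a hab.symm ha hs hlt⟩
    · gcongr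
      intro ρ hρ
      have hρ' : (d : ℝ) ≤ ρ := hρ
      exact hs.imp (fun h => ballIn_mono G A c hρ' h) (fun h => ballIn_mono G A c hρ' h)
  · have : {ρ | ¬ (a ∈ ballIn G A c ρ ↔ b ∈ ballIn G A c ρ)} = ∅ := by
      ext ρ
      simp only [Set.mem_ofPred_eq, Set.mem_empty_iff_false, iff_false, not_not]
      constructor
      · intro hρ
        obtain ⟨k, hk, hk'⟩ := ballIn_nat G A c a hρ
        exact absurd ⟨k, Or.inl hk'⟩ h
      · intro hρ
        obtain ⟨k, hk, hk'⟩ := ballIn_nat G A c b hρ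
        exact absurd ⟨k, Or.inr hk'⟩ h
    rw [this]
    simp

variable (choose : List (Set V) → V)

lemma histC_congr (r r' : ℕ → ℝ) (t : ℕ) (h : ∀ s < t, r s = r' s) :
    histC G choose r t = histC G choose r' t := by
  induction t with
  | zero => rfl
  | succ t ih =>
    simp only [histC]
    rw [ih (fun s hs => h s (by omega)), h t (by omega)]

lemma remC_succ (r : ℕ → ℝ) (t : ℕ) :
    remC G choose r (t + 1) = remC G choose r t \
      ballIn G (remC G choose r t) (choose (histC G choose r t)) (r t) := rfl

lemma remC_anti (r : ℕ → ℝ) : Antitone (remC G choose r) := by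
  refine antitone_nat_of_succ_le fun t => ?_
  rw [remC_succ]
  exact Set.sdiff_subset

lemma mem_remC_iff (r : ℕ → ℝ) (t : ℕ) (a : V) :
    a ∈ remC G choose r t ↔ ∀ s < t, a ∉ ballAtC G choose r s := by
  induction t with
  | zero => simp [remC, histC]
  | succ t ih =>
    constructor
    · intro h s hs hb
      exact hb.2 (remC_anti G choose r (by omega : s + 1 ≤ t + 1) h)
    · intro h
      have h1 := ih.mpr (fun s hs => h s (by omega))
      by_contra h2
      exact h t (by omega) ⟨h1, h2⟩

/-- The edge `ab` is cut at step `t`. -/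
def CutAt (a b : V) (r : ℕ → ℝ) (t : ℕ) : Prop :=
  (a ∈ remC G choose r t ∧ b ∈ remC G choose r t) ∧
    ¬ (a ∈ remC G choose r (t + 1) ↔ b ∈ remC G choose r (t + 1))

/-- The edge `ab` is touched at step `t`. -/
def TouchAt (a b : V) (r : ℕ → ℝ) (t : ℕ) : Prop :=
  (a ∈ remC G choose r t ∧ b ∈ remC G choose r t) ∧
    ¬ (a ∈ remC G choose r (t + 1) ∧ b ∈ remC G choose r (t + 1))

lemma exists_cut (a b : V) (r : ℕ → ℝ) (T : ℕ)
    (h : colC G choose r T a ≠ colC G choose r T b) :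
    ∃ t < T, CutAt G choose a b r t := by
  have h1 : ∃ t, t < T ∧ ¬ (a ∈ ballAtC G choose r t ↔ b ∈ ballAtC G choose r t) := by
    by_contra hc
    push Not at hc
    apply h
    have : (fun t => t < T ∧ a ∈ ballAtC G choose r t) =
        (fun t => t < T ∧ b ∈ ballAtC G choose r t) := by
      funext t
      apply propext
      constructor
      · rintro ⟨h1, h2⟩; exact ⟨h1, (hc t h1).1 h2⟩
      · rintro ⟨h1, h2⟩; exact ⟨h1, (hc t h1).2 h2⟩
    unfold colC
    have key : ∀ (p q : ℕ → Prop) (_ : p = q) (dp : DecidablePred p) (dq : DecidablePred q)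
        (ep : Decidable (∃ t, p t)) (eq : Decidable (∃ t, q t)),
        (if h : ∃ t, p t then Nat.find h + 1 else 0) =
        (if h : ∃ t, q t then Nat.find h + 1 else 0) := by
      rintro p q rfl dp dq ep eq
      have h1 : dp = dq := Subsingleton.elim _ _
      have h2 : ep = eq := Subsingleton.elim _ _
      subst h1 h2
      rfl
    exact key _ _ this _ _ _ _
  have hs := Nat.find_spec h1
  have hm := fun s hs => Nat.find_min h1 (m := s) hs
  generalize Nat.find h1 = t at hs hm
  have hm' : ∀ s < t, (a ∈ ballAtC G choose r s ↔ b ∈ ballAtC G choose r s) := by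
    intro s hst
    by_contra hc
    exact hm s hst ⟨by omega, hc⟩
  have hiff : a ∈ remC G choose r t ↔ b ∈ remC G choose r t := by
    rw [mem_remC_iff, mem_remC_iff]
    constructor
    · intro h s hs; rw [← hm' s hs]; exact h s hs
    · intro h s hs; rw [hm' s hs]; exact h s hs
  refine ⟨t, hs.1, ?_⟩
  have h2 := hs.2
  simp only [ballAtC, Set.mem_sdiff] at h2
  unfold CutAt
  tauto

lemma rOf_meas {n : ℕ} (t : ℕ) : Measurable (fun ω : Fin n → ℝ => rOf ω t) := by
  unfold rOf
  split_ifs with h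
  · exact measurable_pi_apply _
  · exact measurable_const

lemma ballIn_meas [Finite V] (A : Set V) (c : V) (P : Set V → Prop) :
    MeasurableSet {ρ | P (ballIn G A c ρ)} := by
  have h1 : ∀ v, MeasurableSet {ρ | v ∈ ballIn G A c ρ} := by
    intro v
    have : IsUpperSet {ρ | v ∈ ballIn G A c ρ} := fun x y hxy hx => ballIn_mono G A c hxy hx
    exact this.ordConnected.measurableSet
  have h2 : {ρ | P (ballIn G A c ρ)} =
      ⋃ S : Set V, ⋃ _ : P S, ⋂ v : V, {ρ | v ∈ ballIn G A c ρ ↔ v ∈ S} := by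
    ext ρ
    simp only [Set.mem_ofPred_eq, Set.mem_iUnion, Set.mem_iInter, exists_prop]
    constructor
    · intro h; exact ⟨_, h, fun _ => Iff.rfl⟩
    · rintro ⟨S, hS, h⟩
      rwa [Set.ext h]
  rw [h2]
  refine MeasurableSet.iUnion fun S => MeasurableSet.iUnion fun _ => MeasurableSet.iInter fun v => ?_
  by_cases hv : v ∈ S
  · simpa [hv] using h1 v
  · have h3 : {ρ | v ∈ ballIn G A c ρ ↔ v ∈ S} = {ρ | v ∈ ballIn G A c ρ}ᶜ := by
      ext ρ; simp [hv]
    rw [h3]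
    exact (h1 v).compl

lemma histC_meas [Finite V] {n : ℕ} (t : ℕ) (P : List (Set V) → Prop) :
    MeasurableSet {ω : Fin n → ℝ | P (histC G choose (rOf ω) t)} := by
  induction t generalizing P with
  | zero => simp [histC]
  | succ t ih =>
    have h2 : {ω : Fin n → ℝ | P (histC G choose (rOf ω) (t + 1))} =
        ⋃ l : List (Set V), {ω : Fin n → ℝ | histC G choose (rOf ω) t = l} ∩
          (fun ω => rOf ω t) ⁻¹'
            {ρ | P ((l.headI \ ballIn G l.headI (choose l) ρ) :: l)} := by
      ext ω
      simp only [Set.mem_ofPred_eq, Set.mem_iUnion, Set.mem_inter_iff, Set.mem_preimage]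
      constructor
      · intro h; exact ⟨_, rfl, h⟩
      · rintro ⟨l, rfl, h⟩; exact h
    rw [h2]
    refine MeasurableSet.iUnion fun l => (ih (fun x => x = l)).inter ?_
    exact rOf_meas t (ballIn_meas G l.headI (choose l)
      (fun S => P ((l.headI \ S) :: l)))

lemma remC_meas [Finite V] {n : ℕ} (t : ℕ) (a : V) :
    MeasurableSet {ω : Fin n → ℝ | a ∈ remC G choose (rOf ω) t} :=
  histC_meas G choose t (fun l => a ∈ l.headI)

lemma cut_meas [Finite V] {n : ℕ} (t : ℕ) (a b : V) :
    MeasurableSet {ω : Fin n → ℝ | CutAt G choose a b (rOf ω) t} := by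
  have h := remC_meas (n := n) G choose
  unfold CutAt
  exact ((h t a).inter (h t b)).inter ((h (t + 1) a).iff (h (t + 1) b)).compl

lemma touch_meas [Finite V] {n : ℕ} (t : ℕ) (a b : V) :
    MeasurableSet {ω : Fin n → ℝ | TouchAt G choose a b (rOf ω) t} := by
  have h := remC_meas (n := n) G choose
  unfold TouchAt
  exact ((h t a).inter (h t b)).inter ((h (t + 1) a).inter (h (t + 1) b)).compl

lemma cut_le_touch [Finite V] {n : ℕ} (R : ℝ) (hR : 0 < R) (t : ℕ) (ht : t < n) (a b : V)
    (hab : G.Adj a b) :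
    (Measure.pi fun _ : Fin n => expo R) {ω | CutAt G choose a b (rOf ω) t} ≤
      ENNReal.ofReal (1 / R) *
      (Measure.pi fun _ : Fin n => expo R) {ω | TouchAt G choose a b (rOf ω) t} := by
  have := expo_prob R hR
  have hc := cut_meas (n := n) G choose t a b
  have hT := touch_meas (n := n) G choose t a b
  rw [← lintegral_indicator_one hc, ← lintegral_indicator_one hT, ← lintegral_const_mul _
    (measurable_one.indicator hT)]
  refine lintegral_le_of_lmarginal_le {(⟨t, ht⟩ : Fin n)} (measurable_one.indicator hc)
    ((measurable_one.indicator hT).const_mul _) ?_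
  rw [lmarginal_singleton, lmarginal_singleton]
  intro ω
  have hup : Measurable (fun x : ℝ => Function.update ω (⟨t, ht⟩ : Fin n) x) :=
    measurable_update ω
  have hcomp : ∀ S : Set (Fin n → ℝ), MeasurableSet S →
      ∫⁻ x, S.indicator (1 : (Fin n → ℝ) → ℝ≥0∞) (Function.update ω (⟨t, ht⟩ : Fin n) x) ∂(expo R) =
        expo R {x | Function.update ω (⟨t, ht⟩ : Fin n) x ∈ S} := by
    intro S hS
    exact lintegral_indicator_one (μ := expo R) (hup hS)
  show ∫⁻ x, _ ∂(expo R) ≤ ∫⁻ x, _ ∂(expo R)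
  rw [lintegral_const_mul (μ := expo R) (f := fun x => Set.indicator _ 1 (Function.update ω (⟨t, ht⟩ : Fin n) x)) _
    ((measurable_one.indicator hT).comp hup), hcomp _ hc, hcomp _ hT]
  have hh : ∀ x, histC G choose (rOf (Function.update ω (⟨t, ht⟩ : Fin n) x)) t =
      histC G choose (rOf ω) t := by
    intro x
    apply histC_congr
    intro s hs
    unfold rOf
    rw [dif_pos (by omega), dif_pos (by omega), Function.update_of_ne]
    simp only [ne_eq, Fin.mk.injEq]
    omega
  have hr : ∀ x, remC G choose (rOf (Function.update ω (⟨t, ht⟩ : Fin n) x)) t =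
      remC G choose (rOf ω) t := by
    intro x; unfold remC; rw [hh]
  have hx : ∀ x, rOf (Function.update ω (⟨t, ht⟩ : Fin n) x) t = x := by
    intro x; unfold rOf; rw [dif_pos ht, Function.update_self]
  simp only [Set.mem_ofPred_eq, CutAt, TouchAt, remC_succ, hr, hh, hx]
  by_cases h : a ∈ remC G choose (rOf ω) t ∧ b ∈ remC G choose (rOf ω) t
  · have := one_dim G R hR (remC G choose (rOf ω) t) (choose (histC G choose (rOf ω) t)) a b hab
      h.1 h.2
    convert this using 4
    · simp only [h, Set.mem_sdiff]; tauto
    · funext x; simp only [h, Set.mem_sdiff, eq_iff_iff]; tauto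
  · simp [h]

lemma edge_bound [Finite V] {n : ℕ} (R : ℝ) (hR : 0 < R) (a b : V) (hab : G.Adj a b) :
    (Measure.pi fun _ : Fin n => expo R) {ω | ∃ t < n, CutAt G choose a b (rOf ω) t} ≤
      ENNReal.ofReal (1 / R) := by
  have := expo_prob R hR
  set μ := (Measure.pi fun _ : Fin n => expo R) with hμ
  have h1 : {ω : Fin n → ℝ | ∃ t < n, CutAt G choose a b (rOf ω) t} =
      ⋃ t ∈ Finset.range n, {ω | CutAt G choose a b (rOf ω) t} := by
    ext ω; simp
  rw [h1]
  calc _ ≤ ∑ t ∈ Finset.range n, μ {ω | CutAt G choose a b (rOf ω) t} :=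
        measure_biUnion_finset_le _ _
    _ ≤ ∑ t ∈ Finset.range n, ENNReal.ofReal (1 / R) * μ {ω | TouchAt G choose a b (rOf ω) t} :=
        Finset.sum_le_sum fun t ht => cut_le_touch G choose R hR t (Finset.mem_range.mp ht) a b hab
    _ = ENNReal.ofReal (1 / R) * μ (⋃ t ∈ Finset.range n, {ω | TouchAt G choose a b (rOf ω) t}) := by
        rw [← Finset.mul_sum, measure_biUnion_finset]
        · have key : ∀ s t : ℕ, s < t → Disjoint {ω : Fin n → ℝ | TouchAt G choose a b (rOf ω) s}
              {ω | TouchAt G choose a b (rOf ω) t} := by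
            intro s t hst
            rw [Set.disjoint_left]
            rintro ω hs ht
            have hanti := remC_anti G choose (rOf ω) (by omega : s + 1 ≤ t)
            exact hs.2 ⟨hanti ht.1.1, hanti ht.1.2⟩
          intro s _ t _ hst
          rcases lt_or_gt_of_ne hst with h | h
          · exact key s t h
          · exact (key t s h).symm
        · intro t _
          exact touch_meas G choose t a b
    _ ≤ ENNReal.ofReal (1 / R) * 1 := by
        gcongr
        exact prob_le_one
    _ = _ := mul_one _

end Helpers

theorem coloring_process_expected_color_changes
    {V : Type} [Fintype V] (G : SimpleGraph V) (R : ℝ) (hR : 0 < R)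
    (choose : List (Set V) → V)
    -- the center is always chosen among the remaining vertices:
    (hchoose : ∀ l : List (Set V), (l.headI).Nonempty → choose l ∈ l.headI)
    -- a fixed path P = (p_0, …, p_Q) in G, with Q = pw.length and p_i = pw.getVert i:
    {u v : V} (pw : G.Walk u v) (hpath : pw.IsPath)
    -- a stopping time: whether τ ≤ t is determined by the removal history up to time t,
    -- and τ is uniformly bounded (by |V|, since each step removes at least one vertex):
    (τ : (Fin (Fintype.card V) → ℝ) → ℕ)
    (hτ_le : ∀ ω, τ ω ≤ Fintype.card V)
    (hτ_stop : ∀ ω ω' t, histC G choose (rOf ω) t = histC G choose (rOf ω') t →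
      (τ ω ≤ t ↔ τ ω' ≤ t)) :
    ∫ ω, ((Set.ncard {i : ℕ | i < pw.length ∧
          colC G choose (rOf ω) (τ ω) (pw.getVert i) ≠
            colC G choose (rOf ω) (τ ω) (pw.getVert (i + 1))} : ℝ))
        ∂(Measure.pi fun _ : Fin (Fintype.card V) => expo R)
      ≤ 4 * pw.length / R := by
  have := expo_prob R hR
  let n := Fintype.card V
  let μ := (Measure.pi fun _ : Fin n => expo R)
  let C : ℕ → Set (Fin n → ℝ) := fun i =>
    {ω | ∃ t < n, CutAt G choose (pw.getVert i) (pw.getVert (i + 1)) (rOf ω) t}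
  have hCm : ∀ i, MeasurableSet (C i) := by
    intro i
    have : C i = ⋃ t ∈ Finset.range n,
        {ω | CutAt G choose (pw.getVert i) (pw.getVert (i + 1)) (rOf ω) t} := by
      ext ω; simp [C]
    rw [this]
    exact Finset.measurableSet_biUnion _ fun t _ => cut_meas G choose t _ _
  have hint : ∀ i ∈ Finset.range pw.length,
      Integrable ((C i).indicator (fun _ => (1 : ℝ))) μ := fun i _ =>
    (integrable_const (1 : ℝ)).indicator (hCm i)
  calc _ ≤ ∫ ω, ∑ i ∈ Finset.range pw.length, (C i).indicator (fun _ => (1 : ℝ)) ω ∂μ := by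
        refine integral_mono_of_nonneg (Filter.Eventually.of_forall fun ω => by positivity)
          (integrable_finsetSum _ hint) (Filter.Eventually.of_forall fun ω => ?_)
        have hsub : {i : ℕ | i < pw.length ∧
            colC G choose (rOf ω) (τ ω) (pw.getVert i) ≠
            colC G choose (rOf ω) (τ ω) (pw.getVert (i + 1))} ⊆
            (((Finset.range pw.length).filter fun i => ω ∈ C i : Finset ℕ) : Set ℕ) := by
          rintro i ⟨hi, hne⟩
          obtain ⟨t, ht, hcut⟩ := exists_cut G choose _ _ _ _ hne
          simp only [Finset.coe_filter, Finset.mem_range, Set.mem_ofPred_eq]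
          exact ⟨hi, t, lt_of_lt_of_le ht (hτ_le ω), hcut⟩
        have hcard := Set.ncard_le_ncard hsub (Finset.finite_toSet _)
        rw [Set.ncard_coe_finset] at hcard
        have hsum : ∑ i ∈ Finset.range pw.length, (C i).indicator (fun _ => (1 : ℝ)) ω =
            (((Finset.range pw.length).filter fun i => ω ∈ C i).card : ℝ) := by
          rw [Finset.card_filter]
          push_cast
          exact Finset.sum_congr rfl fun i _ => by simp [Set.indicator_apply]
        simp only [hsum]
        exact_mod_cast hcard
    _ = ∑ i ∈ Finset.range pw.length, μ.real (C i) := by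
        rw [integral_finsetSum _ hint]
        exact Finset.sum_congr rfl fun i _ => by
          rw [integral_indicator_const _ (hCm i)]; simp
    _ ≤ ∑ i ∈ Finset.range pw.length, 1 / R := by
        refine Finset.sum_le_sum fun i hi => ?_
        have h := edge_bound (n := n) G choose R hR _ _
          (pw.adj_getVert_succ (Finset.mem_range.mp hi))
        exact ENNReal.toReal_le_of_le_ofReal (by positivity) h
    _ ≤ 4 * pw.length / R := by
        rw [Finset.sum_const, Finset.card_range, nsmul_eq_mul, mul_one_div]
        gcongr
        have : (0 : ℝ) ≤ pw.length := by positivity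
        linarith
end

section
/- Let α = √2 − 1 (so 1 − 2α − α² = 0), let A ≥ ε^{-1} with 0 < ε ≤ 1, let 0 < δ ≤ 1/10, let n ≥ 1 with Aεn ≥ 1, and set R = n/(Aεn)^{1−α} and T = n/(Aεn)^{α}. Then each of the following five quantities is at most √(log δ^{-1}) · A^{α} n^{α} / ε^{1−α}: (i) (√(log δ^{-1})/ε) · R; (ii) (√(log δ^{-1})/ε) · (T/R); (iii) (√(log δ^{-1})/ε) · (n/T); (iv) (T/R) · √(log δ^{-1}) · A^{α} T^{α} / ε^{1−α}; and (v) A · R. Consequently, the function f₀(x) = √(log δ^{-1}) · (Ax)^{α} / ε^{1−α} satisfies the recursion f₀(n) ≥ max( (√(log δ^{-1})/ε) · max(R, T/R, n/T), (T/R) · f₀(T), A · R ). -/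
/- STATEMENT 17: the arithmetic verification of the recursion in the approximate-DP
bounded-weight analysis. With α = √2 − 1 (so 1 − 2α − α² = 0), A ≥ ε⁻¹, 0 < ε ≤ 1,
0 < δ ≤ 1/10, n ≥ 1 with Aεn ≥ 1, R = n/(Aεn)^{1−α}, T = n/(Aεn)^{α}, each of the five
listed quantities is at most √(log δ⁻¹)·A^α n^α/ε^{1−α}, and consequently
f₀(x) = √(log δ⁻¹)·(Ax)^α/ε^{1−α} satisfies the recursion
f₀(n) ≥ max(√(log δ⁻¹)/ε · max(R, T/R, n/T), (T/R)·f₀(T), A·R). -/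

open Real

theorem bounded_weight_recursion_arithmetic
    (A ε δ n : ℝ)
    (hε0 : 0 < ε) (hε1 : ε ≤ 1) (hδ0 : 0 < δ) (hδ1 : δ ≤ 1 / 10)
    (hA : ε⁻¹ ≤ A) (hn : 1 ≤ n) (hAen : 1 ≤ A * ε * n) :
    let α : ℝ := Real.sqrt 2 - 1
    let R : ℝ := n / (A * ε * n) ^ (1 - α)
    let T : ℝ := n / (A * ε * n) ^ α
    let B : ℝ := Real.sqrt (Real.log δ⁻¹) * A ^ α * n ^ α / ε ^ (1 - α)
    let f₀ : ℝ → ℝ := fun x => Real.sqrt (Real.log δ⁻¹) * (A * x) ^ α / ε ^ (1 - α)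
    (1 - 2 * α - α ^ 2 = 0) ∧
    (Real.sqrt (Real.log δ⁻¹) / ε * R ≤ B) ∧
    (Real.sqrt (Real.log δ⁻¹) / ε * (T / R) ≤ B) ∧
    (Real.sqrt (Real.log δ⁻¹) / ε * (n / T) ≤ B) ∧
    (T / R * (Real.sqrt (Real.log δ⁻¹) * A ^ α * T ^ α / ε ^ (1 - α)) ≤ B) ∧
    (A * R ≤ B) ∧
    max (max (Real.sqrt (Real.log δ⁻¹) / ε * max R (max (T / R) (n / T)))
          (T / R * f₀ T)) (A * R) ≤ f₀ n := by
  intro α R T B f₀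
  have hs2 : Real.sqrt 2 ^ 2 = 2 := Real.sq_sqrt (by norm_num)
  have hs0 : 0 ≤ Real.sqrt 2 := Real.sqrt_nonneg 2
  have hα : 1 - 2 * α - α ^ 2 = 0 := by
    simp only [α]
    linear_combination -hs2
  have hα3 : 1 - 2 * α ≤ α := by
    simp only [α]
    nlinarith
  have hS : 1 ≤ Real.sqrt (Real.log δ⁻¹) := by
    rw [Real.one_le_sqrt, Real.le_log_iff_exp_le (by positivity)]
    have h1 : (10 : ℝ) ≤ δ⁻¹ := by
      rw [le_inv_comm₀ (by norm_num) hδ0]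
      linarith
    have := Real.exp_one_lt_d9
    linarith
  have hA0 : 0 < A := lt_of_lt_of_le (by positivity) hA
  have hn0 : 0 < n := by linarith
  have hAe : 1 ≤ A * ε := by
    have := mul_le_mul_of_nonneg_right hA hε0.le
    rwa [inv_mul_cancel₀ hε0.ne'] at this
  have hX0 : 0 < A * ε * n := by positivity
  have hP0 : 0 < (A * ε * n) ^ α := Real.rpow_pos_of_pos hX0 _
  have hQ0 : 0 < (A * ε * n) ^ (α ^ 2) := Real.rpow_pos_of_pos hX0 _
  have hεα : 0 < ε ^ α := Real.rpow_pos_of_pos hε0 _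
  have hX1 : (A * ε * n) ^ (1 - α) = A * ε * n / (A * ε * n) ^ α := by
    rw [Real.rpow_sub hX0, Real.rpow_one]
  have hε2 : ε ^ (1 - α) = ε / ε ^ α := by
    rw [Real.rpow_sub hε0, Real.rpow_one]
  have hXm : (A * ε * n) ^ α = A ^ α * ε ^ α * n ^ α := by
    rw [Real.mul_rpow (by positivity) hn0.le, Real.mul_rpow hA0.le hε0.le]
  have hB : B = Real.sqrt (Real.log δ⁻¹) / ε * (A * ε * n) ^ α := by
    simp only [B]
    rw [hε2, hXm]
    field_simp
  have hR : R = (A * ε * n) ^ α / (A * ε) := by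
    simp only [R]
    rw [hX1]
    field_simp
  have hTR : T / R = (A * ε * n) ^ (α ^ 2) := by
    have h2 : α ^ 2 = (1 - α) - α := by linarith
    rw [h2, Real.rpow_sub hX0]
    have h3 : 0 < (A * ε * n) ^ (1 - α) := Real.rpow_pos_of_pos hX0 _
    simp only [T, R]
    field_simp
  have hT0 : 0 < T := by positivity
  have hTα : T ^ α = n ^ α / (A * ε * n) ^ (α ^ 2) := by
    simp only [T]
    rw [Real.div_rpow hn0.le hP0.le, ← Real.rpow_mul hX0.le, sq]
  have hnT : n / T = (A * ε * n) ^ α := by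
    simp only [T]
    field_simp
  have hSε : 0 ≤ Real.sqrt (Real.log δ⁻¹) / ε := by positivity
  have h1 : Real.sqrt (Real.log δ⁻¹) / ε * R ≤ B := by
    rw [hB, hR]
    exact mul_le_mul_of_nonneg_left (div_le_self hP0.le hAe) hSε
  have h2 : Real.sqrt (Real.log δ⁻¹) / ε * (T / R) ≤ B := by
    rw [hB, hTR]
    exact mul_le_mul_of_nonneg_left
      (Real.rpow_le_rpow_of_exponent_le hAen (by linarith)) hSε
  have h3 : Real.sqrt (Real.log δ⁻¹) / ε * (n / T) ≤ B := by
    rw [hB, hnT]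
  have h4 : T / R * (Real.sqrt (Real.log δ⁻¹) * A ^ α * T ^ α / ε ^ (1 - α)) ≤ B := by
    apply le_of_eq
    rw [hTR, hTα]
    simp only [B]
    field_simp
  have h5 : A * R ≤ B := by
    have h6 : A * R = 1 / ε * (A * ε * n) ^ α := by
      rw [hR]
      field_simp
    rw [h6, hB]
    gcongr
  have hf : ∀ x, 0 < x →
      f₀ x = Real.sqrt (Real.log δ⁻¹) * A ^ α * x ^ α / ε ^ (1 - α) := by
    intro x hx
    simp only [f₀]
    rw [Real.mul_rpow hA0.le hx.le, mul_assoc]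
  refine ⟨hα, h1, h2, h3, h4, h5, ?_⟩
  rw [hf n hn0, hf T hT0]
  refine max_le (max_le ?_ h4) h5
  rw [mul_max_of_nonneg _ _ hSε, mul_max_of_nonneg _ _ hSε]
  exact max_le h1 (max_le h2 h3)
end
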